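/- Let M be a path-connected topological space, n a natural number, and G : M → Matrix n n ℝ a function assigning to each point a symmetric real matrix (possibly singular). Suppose that for every continuous path γ : [0,1] → M there exists a family of invertible matrices L : [0,1] → [0,1] → Matrix n n ℝ satisfying L(s,s) = 1, L(t,r) * L(s,t) = L(s,r) for all r,s,t ∈ [0,1], and G(γ(s)) = (L(s,t))ᵀ * G(γ(t)) * L(s,t) for all s,t ∈ [0,1]. Then the number of positive eigenvalues and the number of negative eigenvalues of G(x) (counted with multiplicity) are independent of x ∈ M. Conversely, if these two counts are independent of x ∈ M, then for every continuous path γ : [0,1] → M such a compatible transport family exists. -/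

import Mathlib

open Matrix

namespace Matrix

variable {ι R : Type*} [Fintype ι] [DecidableEq ι]

/-- Two square matrices are congruent if they represent the same bilinear form up to an
invertible change of basis. -/
def IsCongruent [CommRing R] (A B : Matrix ι ι R) : Prop :=
  ∃ P : Matrix ι ι R, IsUnit P ∧ A = Pᵀ * B * P

namespace IsCongruent

section CommRing

variable [CommRing R] {A B C : Matrix ι ι R}

theorem symm (h : IsCongruent A B) : IsCongruent B A := by
  obtain ⟨P, hP, rfl⟩ := h
  obtain ⟨u, rfl⟩ := hP
  refine ⟨(u⁻¹ : (Matrix ι ι R)ˣ), Units.isUnit _, ?_⟩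
  have h : (u : Matrix ι ι R) * (u⁻¹ : (Matrix ι ι R)ˣ) = 1 := u.mul_inv
  have ht := congrArg transpose h
  rw [transpose_mul, transpose_one] at ht
  simp only [mul_assoc, h, mul_one]
  rw [← mul_assoc, ht, one_mul]

theorem trans (h : IsCongruent A B) (h' : IsCongruent B C) : IsCongruent A C := by
  obtain ⟨P, hP, rfl⟩ := h
  obtain ⟨Q, hQ, rfl⟩ := h'
  exact ⟨Q * P, hQ.mul hP, by simp only [transpose_mul, mul_assoc]⟩

theorem equivalent_toQuadraticForm' (h : IsCongruent A B) :
    QuadraticMap.Equivalent A.toQuadraticForm' B.toQuadraticForm' := by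
  obtain ⟨P, hP, rfl⟩ := h
  have : Invertible P := hP.invertible
  refine ⟨{ toLinearEquiv := toLinearEquiv' P ‹_›, map_app' := fun v => ?_ }⟩
  change toLinearMap₂' R B (P *ᵥ v) (P *ᵥ v) = toLinearMap₂' R (Pᵀ * B * P) v v
  simp only [toLinearMap₂'_apply', ← mulVec_mulVec, dotProduct_mulVec, vecMul_transpose]

end CommRing

/-- Diagonal real matrices whose entries agree in sign up to a permutation are congruent. -/
theorem diagonal_of_sign_eq {v w : ι → ℝ} (σ : ι ≃ ι)
    (h : ∀ i, SignType.sign (w (σ i)) = SignType.sign (v i)) :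
    IsCongruent (diagonal v) (diagonal w) := by
  have hc : ∀ i, ∃ c : ℝ, c ≠ 0 ∧ v i = c * w (σ i) * c := by
    intro i
    have hi := h i
    rcases lt_trichotomy (v i) 0 with hv | hv | hv
    · rw [sign_neg hv, sign_eq_neg_one_iff] at hi
      have hpos := div_pos_of_neg_of_neg hv hi
      refine ⟨√(v i / w (σ i)), (Real.sqrt_pos.2 hpos).ne', ?_⟩
      rw [mul_right_comm, Real.mul_self_sqrt hpos.le, div_mul_cancel₀ _ hi.ne]
    · rw [hv, sign_zero, sign_eq_zero_iff] at hi
      exact ⟨1, one_ne_zero, by simp [hv, hi]⟩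
    · rw [sign_pos hv, sign_eq_one_iff] at hi
      have hpos := div_pos hv hi
      refine ⟨√(v i / w (σ i)), (Real.sqrt_pos.2 hpos).ne', ?_⟩
      rw [mul_right_comm, Real.mul_self_sqrt hpos.le, div_mul_cancel₀ _ hi.ne']
  choose c hc₀ hc using hc
  refine ⟨(1 : Matrix ι ι ℝ).submatrix id σ * diagonal c, ?_, ?_⟩
  · rw [isUnit_iff_isUnit_det, isUnit_iff_ne_zero, det_mul, det_permute', det_diagonal]
    simp [Finset.prod_ne_zero_iff, hc₀]
  · have h : (diagonal w).submatrix σ σ =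
        ((1 : Matrix ι ι ℝ).submatrix id σ)ᵀ * diagonal w * (1 : Matrix ι ι ℝ).submatrix id σ := by
      ext i j
      rcases eq_or_ne i j with rfl | hij <;> simp_all [mul_apply, one_apply, diagonal_apply]
    calc diagonal v = diagonal c * (diagonal w).submatrix σ σ * diagonal c := by
          simp [submatrix_diagonal_equiv, ← hc]
      _ = _ := by simp only [h, transpose_mul, diagonal_transpose, mul_assoc]

end IsCongruent

theorem toQuadraticForm'_diagonal (w : ι → ℝ) :
    (diagonal w).toQuadraticForm' = QuadraticMap.weightedSumSquares ℝ w := by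
  ext v
  change toLinearMap₂' ℝ (diagonal w) v v = _
  simp [toLinearMap₂'_apply', dotProduct, mulVec_diagonal, mul_left_comm]

namespace IsHermitian

variable {A B : Matrix ι ι ℝ}

theorem isCongruent_diagonal_eigenvalues (hA : A.IsHermitian) :
    IsCongruent A (diagonal hA.eigenvalues) := by
  refine ⟨star (hA.eigenvectorUnitary : Matrix ι ι ℝ),
    (Unitary.toUnits (star hA.eigenvectorUnitary)).isUnit, ?_⟩
  conv_lhs => rw [hA.spectral_theorem, Unitary.conjStarAlgAut_apply]
  simp [star_eq_conjTranspose]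

theorem sigPos_toQuadraticForm' (hA : A.IsHermitian) :
    sigPos A.toQuadraticForm' = Nat.card {i // 0 < hA.eigenvalues i} :=
  QuadraticForm.sigPos_of_equiv_weightedSumSquares <| by
    rw [← toQuadraticForm'_diagonal]
    exact hA.isCongruent_diagonal_eigenvalues.equivalent_toQuadraticForm'

theorem sigNeg_toQuadraticForm' (hA : A.IsHermitian) :
    sigNeg A.toQuadraticForm' = Nat.card {i // hA.eigenvalues i < 0} :=
  QuadraticForm.sigNeg_of_equiv_weightedSumSquares <| by
    rw [← toQuadraticForm'_diagonal]
    exact hA.isCongruent_diagonal_eigenvalues.equivalent_toQuadraticForm'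

/-- **Sylvester's law of inertia** for real symmetric matrices. -/
theorem isCongruent_iff_card_eigenvalues (hA : A.IsHermitian) (hB : B.IsHermitian) :
    IsCongruent A B ↔
      Nat.card {i // 0 < hA.eigenvalues i} = Nat.card {i // 0 < hB.eigenvalues i} ∧
      Nat.card {i // hA.eigenvalues i < 0} = Nat.card {i // hB.eigenvalues i < 0} := by
  constructor
  · intro h
    rw [← hA.sigPos_toQuadraticForm', ← hB.sigPos_toQuadraticForm', ← hA.sigNeg_toQuadraticForm',
      ← hB.sigNeg_toQuadraticForm']
    exact ⟨h.equivalent_toQuadraticForm'.sigPos_eq, h.equivalent_toQuadraticForm'.sigNeg_eq⟩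
  · rintro ⟨hp, hn⟩
    let sA := fun i => SignType.sign (hA.eigenvalues i)
    let sB := fun i => SignType.sign (hB.eigenvalues i)
    have hp' : Nat.card {i // sA i = 1} = Nat.card {i // sB i = 1} := by
      simpa only [sA, sB, sign_eq_one_iff] using hp
    have hn' : Nat.card {i // sA i = -1} = Nat.card {i // sB i = -1} := by
      simpa only [sA, sB, sign_eq_neg_one_iff] using hn
    have hsum : ∀ s : ι → SignType, Nat.card {i // s i = 0} + Nat.card {i // s i = -1} +
        Nat.card {i // s i = 1} = Nat.card ι := by
      intro s
      rw [← Nat.card_congr (Equiv.sigmaFiberEquiv s), Nat.card_sigma,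
        SignType.univ_eq]
      simp [add_assoc]
    have hA₀ := hsum sA
    have hB₀ := hsum sB
    have hcard : ∀ c, Nat.card {i // sA i = c} = Nat.card {i // sB i = c} := by
      rintro (_ | _ | _)
      · change Nat.card {i // sA i = 0} = Nat.card {i // sB i = 0}
        lia
      · exact hn'
      · exact hp'
    let σ : ι ≃ ι := Equiv.ofFiberEquiv (f := sA) (g := sB) fun c =>
      (Finite.card_eq.1 (hcard c)).some
    exact (hA.isCongruent_diagonal_eigenvalues.trans <|
      IsCongruent.diagonal_of_sign_eq σ fun i => Equiv.ofFiberEquiv_map (f := sA) (g := sB) _ i).trans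
        hB.isCongruent_diagonal_eigenvalues.symm

end IsHermitian

end Matrix

/-- On a path-connected space `M` with a field `G` of symmetric real matrices,
a compatible invertible transport family exists along every continuous path `γ : [0,1] → M`
iff the numbers of positive and of negative eigenvalues of `G x` (with multiplicity) are
independent of the point `x ∈ M`.
(Over `ℝ`, `Matrix.IsHermitian` means exactly that the matrix is symmetric.) -/
theorem global_compatible_transport_iff_inertia_constant
    {M : Type*} [TopologicalSpace M] [PathConnectedSpace M] {n : ℕ}
    (G : M → Matrix (Fin n) (Fin n) ℝ)
    (hG : ∀ x, (G x).IsHermitian) :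
    (∀ γ : unitInterval → M, Continuous γ →
        ∃ L : unitInterval → unitInterval → Matrix (Fin n) (Fin n) ℝ,
          (∀ s, L s s = 1) ∧
          (∀ r s t, L t r * L s t = L s r) ∧
          (∀ s t, IsUnit (L s t)) ∧
          (∀ s t, G (γ s) = (L s t)ᵀ * G (γ t) * L s t)) ↔
      ∀ x y : M,
        Nat.card {i : Fin n // 0 < (hG x).eigenvalues i} =
            Nat.card {i : Fin n // 0 < (hG y).eigenvalues i} ∧
          Nat.card {i : Fin n // (hG x).eigenvalues i < 0} =
            Nat.card {i : Fin n // (hG y).eigenvalues i < 0} := by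
  constructor
  · intro h x y
    let γ := PathConnectedSpace.somePath x y
    obtain ⟨L, -, -, hunit, hL⟩ := h γ γ.continuous
    exact ((hG x).isCongruent_iff_card_eigenvalues (hG y)).1
      ⟨L 0 1, hunit 0 1, by simpa using hL 0 1⟩
  · intro h γ _
    have hR : ∀ t, ∃ u : (Matrix (Fin n) (Fin n) ℝ)ˣ,
        G (γ t) = (u : Matrix (Fin n) (Fin n) ℝ)ᵀ * G (γ 0) * u := by
      intro t
      obtain ⟨P, hP, hGP⟩ :=
        ((hG (γ t)).isCongruent_iff_card_eigenvalues (hG (γ 0))).2 (h _ _)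
      exact ⟨hP.unit, hGP⟩
    choose u hu using hR
    refine ⟨fun s t => ((u t)⁻¹ * u s : (Matrix (Fin n) (Fin n) ℝ)ˣ), fun s => by simp,
      fun r s t => ?_, fun s t => Units.isUnit _, fun s t => ?_⟩
    · rw [← Units.val_mul]
      congr 1
      group
    · have hcancel : (u t : Matrix (Fin n) (Fin n) ℝ) *
          ((u t)⁻¹ * u s : (Matrix (Fin n) (Fin n) ℝ)ˣ) = u s := by
        rw [← Units.val_mul, mul_inv_cancel_left]
      rw [hu s, hu t, ← hcancel, transpose_mul]
      simp only [hcancel, mul_assoc]
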